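/- arXiv:math/0008007 — 3 statements merged into one kernel-verified Lean document; each statement's English description precedes it below -/
import Mathlib

section
/- For every real number x ≥ 2, one has Γ(1+x)^{2/x} ≤ (1/6)(x+1)(x+2), where Γ denotes the Euler Gamma function. -/
/-- The sum of `1 / (1 + x + m) ^ 2` beyond its first two terms is bounded by telescoping. -/
lemma sum_inv_sq_le {x : ℝ} (hx : 0 ≤ x) (k : ℕ) :
    ∑ m ∈ Finset.range (k + 2), 1 / (1 + x + (m : ℝ)) ^ 2 ≤
      1 / (x + 1) ^ 2 + 1 / (x + 2) ^ 2 + 1 / (x + 5 / 2) - 1 / (x + k + 5 / 2) := by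
  induction k with
  | zero =>
    simp only [Nat.zero_add, Finset.sum_range_succ, Finset.sum_range_zero]
    push_cast
    apply le_of_eq
    ring
  | succ k ih =>
    rw [Finset.sum_range_succ]
    have hk : (0 : ℝ) ≤ k := k.cast_nonneg
    have step : 1 / (1 + x + ((k + 2 : ℕ) : ℝ)) ^ 2 ≤
        1 / (x + k + 5 / 2) - 1 / (x + (k + 1 : ℕ) + 5 / 2) := by
      push_cast
      rw [div_sub_div _ _ (by positivity) (by positivity),
        div_le_div_iff₀ (by positivity) (by positivity)]
      nlinarith
    linarith

/-- The difference of logarithms in the Gamma bound, with `Real.Gamma` replaced by the `n`-th term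
of Euler's limit formula. -/
noncomputable def logGapSeq (n : ℕ) (x : ℝ) : ℝ :=
  x / 2 * (Real.log (x + 1) + Real.log (x + 2) - Real.log 6) -
    Real.BohrMollerup.logGammaSeq (1 + x) n

lemma hasDerivAt_logGapSeq (n : ℕ) {x : ℝ} (hx : 0 ≤ x) :
    HasDerivAt (logGapSeq n)
      (1 / 2 * (Real.log (x + 1) + Real.log (x + 2) - Real.log 6) +
        x / 2 * (1 / (x + 1) + 1 / (x + 2)) -
        (Real.log n - ∑ m ∈ Finset.range (n + 1), 1 / (1 + x + (m : ℝ)))) x := by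
  have h1 : HasDerivAt (fun y : ℝ => Real.log (y + 1)) (1 / (x + 1)) x :=
    ((hasDerivAt_id x).add_const 1).log (by simp; positivity)
  have h2 : HasDerivAt (fun y : ℝ => Real.log (y + 2)) (1 / (x + 2)) x :=
    ((hasDerivAt_id x).add_const 2).log (by simp; positivity)
  have hs : HasDerivAt (fun y : ℝ => ∑ m ∈ Finset.range (n + 1), Real.log (1 + y + (m : ℝ)))
      (∑ m ∈ Finset.range (n + 1), 1 / (1 + x + (m : ℝ))) x :=
    HasDerivAt.fun_sum fun m _ =>
      (((hasDerivAt_id x).const_add 1).add_const (m : ℝ)).log (by simp; positivity)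
  have hl : HasDerivAt (fun y : ℝ => (1 + y) * Real.log n + Real.log n.factorial)
      (1 * Real.log n) x :=
    (((hasDerivAt_id x).const_add 1).mul_const _).add_const _
  have := (((hasDerivAt_id x).div_const 2).mul ((h1.add h2).sub_const (Real.log 6))).sub
    (hl.sub hs)
  refine this.congr_deriv ?_
  simp

lemma hasDerivAt_deriv_logGapSeq (n : ℕ) {x : ℝ} (hx : 0 ≤ x) :
    HasDerivAt (fun x : ℝ => 1 / 2 * (Real.log (x + 1) + Real.log (x + 2) - Real.log 6) +
        x / 2 * (1 / (x + 1) + 1 / (x + 2)) -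
        (Real.log n - ∑ m ∈ Finset.range (n + 1), 1 / (1 + x + (m : ℝ))))
      (1 / (x + 1) + 1 / (x + 2) - x / 2 * (1 / (x + 1) ^ 2 + 1 / (x + 2) ^ 2) -
        ∑ m ∈ Finset.range (n + 1), 1 / (1 + x + (m : ℝ)) ^ 2) x := by
  have hinv {c : ℝ} (hc : 0 < c) :
      HasDerivAt (fun y : ℝ => 1 / (y + c)) (-(1 / (x + c) ^ 2)) x := by
    have := ((hasDerivAt_id x).add_const c).fun_inv (by simp; positivity)
    simpa [neg_div] using this
  have hlog {c : ℝ} (hc : 0 < c) :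
      HasDerivAt (fun y : ℝ => Real.log (y + c)) (1 / (x + c)) x :=
    ((hasDerivAt_id x).add_const c).log (by simp; positivity)
  have hs : HasDerivAt (fun y : ℝ => ∑ m ∈ Finset.range (n + 1), 1 / (1 + y + (m : ℝ)))
      (∑ m ∈ Finset.range (n + 1), -(1 / (1 + x + (m : ℝ)) ^ 2)) x := by
    refine HasDerivAt.fun_sum fun m _ => ?_
    have assoc (y : ℝ) : 1 + y + (m : ℝ) = y + (1 + m) := by ring
    simp only [assoc]
    exact hinv (by positivity)
  have := (((((hlog one_pos).add (hlog two_pos)).sub_const (Real.log 6)).const_mul (1 / 2)).add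
    (((hasDerivAt_id x).div_const 2).mul ((hinv one_pos).add (hinv two_pos)))).sub
    (hs.const_sub (Real.log n))
  refine this.congr_deriv ?_
  simp only [Finset.sum_neg_distrib, id, Pi.add_apply]
  ring

lemma deriv2_logGapSeq_nonneg (k : ℕ) {x : ℝ} (hx : 1 ≤ x) :
    0 ≤ 1 / (x + 1) + 1 / (x + 2) - x / 2 * (1 / (x + 1) ^ 2 + 1 / (x + 2) ^ 2) -
      ∑ m ∈ Finset.range (k + 1 + 1), 1 / (1 + x + (m : ℝ)) ^ 2 := by
  have hx0 : 0 ≤ x := by linarith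
  have hs := sum_inv_sq_le hx0 k
  have hk : 0 ≤ 1 / (x + k + 5 / 2) := by positivity
  have key : 0 ≤ 1 / (x + 1) + 1 / (x + 2) - x / 2 * (1 / (x + 1) ^ 2 + 1 / (x + 2) ^ 2) -
      (1 / (x + 1) ^ 2 + 1 / (x + 2) ^ 2 + 1 / (x + 5 / 2)) := by
    have : 1 / (x + 1) + 1 / (x + 2) - x / 2 * (1 / (x + 1) ^ 2 + 1 / (x + 2) ^ 2) -
        (1 / (x + 1) ^ 2 + 1 / (x + 2) ^ 2 + 1 / (x + 5 / 2)) =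
        (2 * x ^ 2 + 2 * x - 3) / (2 * (x + 1) ^ 2 * (x + 2) * (2 * x + 5)) := by
      field_simp
      ring
    rw [this]
    apply div_nonneg (by nlinarith) (by positivity)
  linarith

lemma convexOn_logGapSeq (k : ℕ) : ConvexOn ℝ (Set.Ici 1) (logGapSeq (k + 1)) := by
  have nonneg_of_mem {x : ℝ} (hx : x ∈ interior (Set.Ici (1 : ℝ))) : 0 ≤ x :=
    zero_le_one.trans (interior_subset hx)
  refine convexOn_of_hasDerivWithinAt2_nonneg (convex_Ici 1)
    (fun x hx => (hasDerivAt_logGapSeq (k + 1)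
      (zero_le_one.trans hx)).continuousAt.continuousWithinAt)
    (fun x hx => (hasDerivAt_logGapSeq (k + 1) (nonneg_of_mem hx)).hasDerivWithinAt)
    (fun x hx => (hasDerivAt_deriv_logGapSeq (k + 1) (nonneg_of_mem hx)).hasDerivWithinAt)
    (fun x hx => deriv2_logGapSeq_nonneg k (interior_subset hx))

lemma tendsto_logGapSeq {x : ℝ} (hx : 0 ≤ x) :
    Filter.Tendsto (fun k : ℕ => logGapSeq (k + 1) x) Filter.atTop
      (nhds (x / 2 * (Real.log (x + 1) + Real.log (x + 2) - Real.log 6) -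
        Real.log (Real.Gamma (1 + x)))) :=
  ((Real.BohrMollerup.tendsto_log_gamma (by positivity : 0 < 1 + x)).comp
    (Filter.tendsto_add_atTop_nat 1)).const_sub _

lemma convexOn_logGap : ConvexOn ℝ (Set.Ici 1) fun x : ℝ =>
    x / 2 * (Real.log (x + 1) + Real.log (x + 2) - Real.log 6) -
      Real.log (Real.Gamma (1 + x)) := by
  refine ⟨convex_Ici 1, fun x hx y hy a b ha hb hab => ?_⟩
  have hz := convex_Ici (1 : ℝ) hx hy ha hb hab
  exact le_of_tendsto_of_tendsto' (tendsto_logGapSeq (zero_le_one.trans hz))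
    (((tendsto_logGapSeq (zero_le_one.trans hx)).const_smul a).add
      ((tendsto_logGapSeq (zero_le_one.trans hy)).const_smul b))
    fun k => (convexOn_logGapSeq k).2 hx hy ha hb hab

/-- The gap vanishes at `1` and `2`, so convexity makes it nonnegative from `2` on. -/
lemma log_Gamma_one_add_le {x : ℝ} (hx : 2 ≤ x) :
    Real.log (Real.Gamma (1 + x)) ≤
      x / 2 * (Real.log (x + 1) + Real.log (x + 2) - Real.log 6) := by
  have gap_one : (1 : ℝ) / 2 * (Real.log (1 + 1) + Real.log (1 + 2) - Real.log 6) -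
      Real.log (Real.Gamma (1 + 1)) = 0 := by
    have hG : Real.Gamma (1 + 1) = 1 := by norm_num
    rw [hG, ← Real.log_mul (by norm_num) (by norm_num)]
    norm_num
  have gap_two : (2 : ℝ) / 2 * (Real.log (2 + 1) + Real.log (2 + 2) - Real.log 6) -
      Real.log (Real.Gamma (1 + 2)) = 0 := by
    have hG : Real.Gamma (1 + 2) = 2 := by
      simpa [add_comm, Nat.factorial] using Real.Gamma_nat_eq_factorial 2
    rw [hG, ← Real.log_mul (by norm_num) (by norm_num),
      ← Real.log_div (by norm_num) (by norm_num)]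
    norm_num
  rcases hx.eq_or_lt with rfl | hlt
  · exact (sub_eq_zero.mp gap_two).ge
  · have h := convexOn_logGap.slope_mono_adjacent (x := 1) (y := 2) (z := x)
      (by simp) (by simp; linarith) one_lt_two hlt
    rw [gap_one, gap_two, sub_zero, sub_zero, zero_div, le_div_iff₀ (sub_pos.mpr hlt)] at h
    linarith

/-- For every real number `x ≥ 2`, `Γ(1+x)^(2/x) ≤ (1/6)(x+1)(x+2)`. -/
theorem gamma_upper_bound_one (x : ℝ) (hx : 2 ≤ x) :
    Real.Gamma (1 + x) ^ (2 / x) ≤ (1 / 6) * (x + 1) * (x + 2) := by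
  have hx0 : 0 < x := by linarith
  have hG : 0 < Real.Gamma (1 + x) := Real.Gamma_pos_of_pos (by positivity)
  rw [← Real.log_le_log_iff (by positivity) (by positivity), Real.log_rpow hG,
    Real.log_mul (by positivity) (by positivity), Real.log_mul (by positivity) (by positivity),
    one_div, Real.log_inv]
  calc 2 / x * Real.log (Real.Gamma (1 + x))
      ≤ 2 / x * (x / 2 * (Real.log (x + 1) + Real.log (x + 2) - Real.log 6)) := by
        gcongr
        exact log_Gamma_one_add_le hx
    _ = -Real.log 6 + Real.log (x + 1) + Real.log (x + 2) := by
        field_simp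
        ring
end

section
/- For all real numbers x and y with 1/2 ≤ x ≤ 1 and y ≥ 2, one has Γ(1+xy)^{1+2/y} / Γ(1+(y+2)x) ≤ Γ(1+x)³ / Γ(1+3x), where Γ denotes the Euler Gamma function. -/
open Filter Topology Real.BohrMollerup

/-- A pointwise limit of functions whose second derivatives are bounded above by a null sequence
is concave. -/
lemma concaveOn_of_tendsto_of_hasDerivAt2_le {D : Set ℝ} (hD : Convex ℝ D)
    {f f' f'' : ℕ → ℝ → ℝ} {g : ℝ → ℝ} {c : ℕ → ℝ}
    (hf : ∀ n, ∀ x ∈ D, HasDerivAt (f n) (f' n x) x)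
    (hf' : ∀ n, ∀ x ∈ D, HasDerivAt (f' n) (f'' n x) x)
    (hle : ∀ n, ∀ x ∈ D, f'' n x ≤ c n) (hc : Tendsto c atTop (𝓝 0))
    (hg : ∀ x ∈ D, Tendsto (fun n => f n x) atTop (𝓝 (g x))) : ConcaveOn ℝ D g := by
  have hconc (n : ℕ) : ConcaveOn ℝ D (fun x => f n x - c n / 2 * x ^ 2) := by
    have h1 (x) (hx : x ∈ D) :
        HasDerivAt (fun x => f n x - c n / 2 * x ^ 2) (f' n x - c n * x) x := by
      refine ((hf n x hx).fun_sub ((hasDerivAt_pow 2 x).const_mul (c n / 2))).congr_deriv ?_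
      push_cast; ring
    have h2 (x) (hx : x ∈ D) :
        HasDerivAt (fun x => f' n x - c n * x) (f'' n x - c n) x := by
      exact ((hf' n x hx).fun_sub ((hasDerivAt_id x).const_mul (c n))).congr_deriv (by ring)
    refine concaveOn_of_hasDerivWithinAt2_nonpos hD
      (fun x hx => (h1 x hx).continuousAt.continuousWithinAt)
      (fun x hx => (h1 x (interior_subset hx)).hasDerivWithinAt)
      (fun x hx => (h2 x (interior_subset hx)).hasDerivWithinAt)
      (fun x hx => sub_nonpos.2 (hle n x (interior_subset hx)))
  have hlim (x) (hx : x ∈ D) :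
      Tendsto (fun n => f n x - c n / 2 * x ^ 2) atTop (𝓝 (g x)) := by
    simpa using (hg x hx).sub ((hc.div_const 2).mul_const (x ^ 2))
  refine ⟨hD, fun x hx y hy a b ha hb hab => ?_⟩
  exact le_of_tendsto_of_tendsto' (((hlim x hx).const_smul a).add ((hlim y hy).const_smul b))
    (hlim _ (hD hx hy ha hb hab)) (fun n => (hconc n).2 hx hy ha hb hab)

lemma ConcaveOn.nonpos_of_left_eq_zero {D : Set ℝ} {f : ℝ → ℝ} (hf : ConcaveOn ℝ D f) {a b t : ℝ}
    (ha : a ∈ D) (ht : t ∈ D) (hab : a < b) (hbt : b ≤ t) (hfa : f a = 0) (hfb : f b ≤ 0) :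
    f t ≤ 0 := by
  have h0 : 0 < t - a := by linarith
  have hw : 0 < (b - a) / (t - a) := div_pos (by linarith) h0
  have h := hf.2 ha ht (div_nonneg (sub_nonneg.2 hbt) h0.le) hw.le (by field_simp; ring)
  have hb : ((t - b) / (t - a)) • a + ((b - a) / (t - a)) • t = b := by
    simp only [smul_eq_mul]; field_simp; ring
  rw [hb, hfa] at h
  simp only [smul_eq_mul, mul_zero, zero_add] at h
  by_contra! hpos
  linarith [mul_pos hw hpos]

lemma hasDerivAt_logGammaSeq {x : ℝ} (hx : 0 < x) (n : ℕ) :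
    HasDerivAt (fun x => logGammaSeq x n)
      (Real.log n - ∑ m ∈ Finset.range (n + 1), 1 / (x + m)) x := by
  unfold logGammaSeq
  have hs : HasDerivAt (fun x : ℝ => ∑ m ∈ Finset.range (n + 1), Real.log (x + m))
      (∑ m ∈ Finset.range (n + 1), 1 / (x + m)) x :=
    HasDerivAt.fun_sum fun m _ => ((hasDerivAt_id x).add_const (m : ℝ)).log (by positivity)
  simpa using (((hasDerivAt_id x).mul_const (Real.log n)).add_const
    (Real.log (n.factorial : ℝ))).fun_sub hs

lemma hasDerivAt_log_sub_sum_one_div {x : ℝ} (hx : 0 < x) (n : ℕ) :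
    HasDerivAt (fun x : ℝ => Real.log n - ∑ m ∈ Finset.range (n + 1), 1 / (x + m))
      (∑ m ∈ Finset.range (n + 1), 1 / (x + m) ^ 2) x := by
  have hs : HasDerivAt (fun x : ℝ => ∑ m ∈ Finset.range (n + 1), 1 / (x + m))
      (∑ m ∈ Finset.range (n + 1), -(1 / (x + m) ^ 2)) x := by
    refine HasDerivAt.fun_sum fun m _ => ?_
    have := ((hasDerivAt_id x).add_const (m : ℝ)).fun_inv (by simp; positivity)
    simpa [neg_div] using this
  simpa using hs.const_sub (Real.log n)

lemma sum_one_div_sq_le {x : ℝ} (hx : 1 / 2 < x) (n : ℕ) :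
    ∑ m ∈ Finset.range n, 1 / (x + m) ^ 2 ≤ 1 / (x - 1 / 2) := by
  suffices h : ∑ m ∈ Finset.range n, 1 / (x + m) ^ 2 ≤ 1 / (x - 1 / 2) - 1 / (x + n - 1 / 2) by
    have : 0 ≤ 1 / (x + n - 1 / 2) :=
      one_div_nonneg.2 (by linarith [Nat.cast_nonneg (α := ℝ) n])
    linarith
  induction n with
  | zero => simp
  | succ n ih =>
    rw [Finset.sum_range_succ]
    have hv : 0 < x + n - 1 / 2 := by linarith [Nat.cast_nonneg (α := ℝ) n]
    have key : 1 / (x + n) ^ 2 ≤ 1 / (x + n - 1 / 2) - 1 / (x + (n + 1 : ℕ) - 1 / 2) := by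
      have hv' : x + (n + 1 : ℕ) - 1 / 2 = (x + n - 1 / 2) + 1 := by push_cast; ring
      have hx' : x + n = (x + n - 1 / 2) + 1 / 2 := by ring
      rw [hv', hx']
      generalize x + n - 1 / 2 = v at hv
      rw [add_sub_cancel_right, div_sub_div _ _ (by positivity) (by positivity),
        div_le_div_iff₀ (by positivity) (by positivity)]
      nlinarith
    linarith

lemma sum_one_div_sq_le' {x : ℝ} (hx : 0 < x) (n : ℕ) :
    ∑ m ∈ Finset.range (n + 1), 1 / (x + m) ^ 2 ≤ 1 / x ^ 2 + 1 / (x + 1 / 2) := by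
  have h := sum_one_div_sq_le (x := x + 1) (by linarith) n
  rw [Finset.sum_range_succ', show x + 1 / 2 = x + 1 - 1 / 2 by ring]
  have : ∀ m : ℕ, x + (m + 1 : ℕ) = x + 1 + m := fun m => by push_cast; ring
  simp only [this, Nat.cast_zero, add_zero]
  linarith

lemma le_sum_one_div_sq {x : ℝ} (hx : 1 / 2 < x) (n : ℕ) :
    1 / (x - 1 / 2) - 1 / (12 * (x - 1 / 2) ^ 3) - 1 / (n + 1) ≤
      ∑ m ∈ Finset.range (n + 1), 1 / (x + m) ^ 2 := by
  have key (N : ℕ) : 1 / (x - 1 / 2) - 1 / (12 * (x - 1 / 2) ^ 3) - (1 / (x + N - 1 / 2)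
      - 1 / (12 * (x + N - 1 / 2) ^ 3)) ≤ ∑ m ∈ Finset.range N, 1 / (x + m) ^ 2 := by
    induction N with
    | zero => simp
    | succ n ih =>
      rw [Finset.sum_range_succ]
      have hv : 0 < x + n - 1 / 2 := by linarith [Nat.cast_nonneg (α := ℝ) n]
      have step : 1 / (x + n - 1 / 2) - 1 / (12 * (x + n - 1 / 2) ^ 3)
          - (1 / (x + (n + 1 : ℕ) - 1 / 2) - 1 / (12 * (x + (n + 1 : ℕ) - 1 / 2) ^ 3))
          ≤ 1 / (x + n) ^ 2 := by
        have hv' : x + (n + 1 : ℕ) - 1 / 2 = (x + n - 1 / 2) + 1 := by push_cast; ring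
        have hx' : 1 / (x + n) ^ 2 = 1 / ((x + n - 1 / 2) + 1 / 2) ^ 2 := by ring_nf
        rw [hv', hx']
        generalize x + n - 1 / 2 = v at hv
        rw [← sub_nonneg]
        have : 1 / (v + 1 / 2) ^ 2 - (1 / v - 1 / (12 * v ^ 3)
            - (1 / (v + 1) - 1 / (12 * (v + 1) ^ 3)))
            = (7 * v ^ 2 + 7 * v + 1) / (12 * v ^ 3 * (v + 1) ^ 3 * (2 * v + 1) ^ 2) := by
          field_simp
          ring
        rw [this]
        positivity
      linarith
  have h := key (n + 1)
  have hv : (n : ℝ) + 1 < x + (n + 1 : ℕ) - 1 / 2 := by push_cast; linarith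
  have h0 : (0 : ℝ) < n + 1 := by positivity
  have h1 := one_div_le_one_div_of_le h0 hv.le
  have h2 : 0 < 1 / (12 * (x + (n + 1 : ℕ) - 1 / 2) ^ 3) := by
    have := h0.trans hv
    positivity
  linarith

lemma one_div_sq_add_one_div_le {t : ℝ} (ht : 1 ≤ t) :
    1 / (1 + t) ^ 2 + 1 / (1 + t + 1 / 2) ≤ (1 / (t + 1) + 1 / (t + 2)) -
      t / 2 * (1 / (t + 1) ^ 2 + 1 / (t + 2) ^ 2) := by
  obtain ⟨s, rfl⟩ : ∃ s, t = 1 + s := ⟨t - 1, by ring⟩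
  have hs : 0 ≤ s := by linarith
  rw [← sub_nonneg]
  have : 0 < 1 + (1 + s) := by linarith
  have : 0 < 1 + (1 + s) + 1 / 2 := by linarith
  have : 0 < 1 + s + 1 := by linarith
  have : 0 < 1 + s + 2 := by linarith
  field_simp
  ring_nf
  positivity

lemma second_deriv_bound_nonpos {x y : ℝ} (hx : 1 / 2 ≤ x) (hx2 : x ≤ 1) (hy : 2 ≤ y) :
    (y + 2) ^ 2 * (1 / ((y + 2) * x + 1 / 2)) - (1 + 2 / y) * y ^ 2 *
      (1 / (y * x + 1 / 2) - 1 / (12 * (y * x + 1 / 2) ^ 3))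
      - 9 * (1 / (3 * x + 1 / 2) - 1 / (12 * (3 * x + 1 / 2) ^ 3)) + 3 * (1 / (x + 1 / 2)) ≤ 0 := by
  have hx0 : 0 < x := by linarith
  have hy0 : 0 < y := by linarith
  have e : (y + 2) ^ 2 * (1 / ((y + 2) * x + 1 / 2)) - (1 + 2 / y) * y ^ 2 *
      (1 / (y * x + 1 / 2) - 1 / (12 * (y * x + 1 / 2) ^ 3))
      - 9 * (1 / (3 * x + 1 / 2) - 1 / (12 * (3 * x + 1 / 2) ^ 3)) + 3 * (1 / (x + 1 / 2)) =
      (y + 2) / (((y + 2) * x + 1 / 2) * (y * x + 1 / 2))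
      + y * (y + 2) / (y * x + 1 / 2) ^ 3 / 12 + 3 / (4 * (3 * x + 1 / 2) ^ 3)
      - 3 / ((3 * x + 1 / 2) * (x + 1 / 2)) := by
    field_simp
    ring
  obtain ⟨w, rfl⟩ : ∃ w, y = 2 + w := ⟨y - 2, by ring⟩
  obtain ⟨p, rfl⟩ : ∃ p, x = 1 / 2 + p := ⟨x - 1 / 2, by ring⟩
  have hw : 0 ≤ w := by linarith
  have hp : 0 ≤ p := by linarith
  have hp2 : p ≤ 1 / 2 := by linarith
  have h1 : (2 + w + 2) / (((2 + w + 2) * (1 / 2 + p) + 1 / 2) * ((2 + w) * (1 / 2 + p) + 1 / 2)) ≤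
      4 / ((4 * (1 / 2 + p) + 1 / 2) * (2 * (1 / 2 + p) + 1 / 2)) := by
    rw [div_le_div_iff₀ (by positivity) (by positivity), ← sub_nonneg]
    ring_nf
    positivity
  have h2 : (2 + w) * (2 + w + 2) / ((2 + w) * (1 / 2 + p) + 1 / 2) ^ 3 ≤
      8 / (2 * (1 / 2 + p) + 1 / 2) ^ 3 := by
    rw [div_le_div_iff₀ (by positivity) (by positivity), ← sub_nonneg]
    ring_nf
    positivity
  have h3 : 4 / ((4 * (1 / 2 + p) + 1 / 2) * (2 * (1 / 2 + p) + 1 / 2))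
      + 8 / (2 * (1 / 2 + p) + 1 / 2) ^ 3 / 12 + 3 / (4 * (3 * (1 / 2 + p) + 1 / 2) ^ 3)
      ≤ 3 / ((3 * (1 / 2 + p) + 1 / 2) * (1 / 2 + p + 1 / 2)) := by
    rw [← sub_nonneg]
    field_simp
    ring_nf
    positivity
  rw [e]
  linarith

lemma tendsto_logGammaSeq_log_Gamma {x : ℝ} (hx : 0 < x) :
    Tendsto (logGammaSeq x) atTop (𝓝 (Real.log (Real.Gamma x))) := by
  have := tendsto_logGammaSeq Real.convexOn_log_Gamma (fun {y} hy => by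
    simp only [Function.comp_apply]
    rw [Real.Gamma_add_one hy.ne', Real.log_mul hy.ne' (Real.Gamma_pos_of_pos hy).ne', add_comm]) hx
  simpa using this

lemma hasDerivAt_logGammaSeq_one_add_mul {c x : ℝ} (hc : 0 ≤ c) (hx : 0 ≤ x) (n : ℕ) :
    HasDerivAt (fun x => logGammaSeq (1 + c * x) n)
      (c * (Real.log n - ∑ m ∈ Finset.range (n + 1), 1 / (1 + c * x + m))) x := by
  have := (hasDerivAt_logGammaSeq (x := 1 + c * x) (by positivity) n).comp x
    (((hasDerivAt_id x).const_mul c).const_add 1)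
  simpa [Function.comp_def, mul_comm] using this

lemma hasDerivAt_mul_log_sub_sum_one_div {c x : ℝ} (hc : 0 ≤ c) (hx : 0 ≤ x) (n : ℕ) :
    HasDerivAt
      (fun x => c * (Real.log n - ∑ m ∈ Finset.range (n + 1), 1 / (1 + c * x + m)))
      (c ^ 2 * ∑ m ∈ Finset.range (n + 1), 1 / (1 + c * x + m) ^ 2) x := by
  refine (((hasDerivAt_log_sub_sum_one_div (x := 1 + c * x) (by positivity) n).comp x
    (((hasDerivAt_id x).const_mul c).const_add 1)).const_mul c).congr_deriv ?_
  ring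

lemma log_Gamma_one_add_le_mul_log {t : ℝ} (ht : 1 ≤ t) :
    Real.log (Real.Gamma (1 + t)) ≤ t * (Real.log (1 + t) + Real.log (Real.pi / 6)) := by
  have hconc : ConcaveOn ℝ (Set.Ici 0) (fun t => Real.log (Real.Gamma (1 + 1 * t)) -
      t * (Real.log (1 + t) + Real.log (Real.pi / 6))) := by
    refine concaveOn_of_tendsto_of_hasDerivAt2_le (convex_Ici 0)
      (f := fun n t => logGammaSeq (1 + 1 * t) n -
        t * (Real.log (1 + t) + Real.log (Real.pi / 6)))
      (f' := fun n t => 1 * (Real.log n - ∑ m ∈ Finset.range (n + 1), 1 / (1 + 1 * t + m)) -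
        (Real.log (1 + t) + Real.log (Real.pi / 6) + (1 - 1 / (1 + t))))
      (f'' := fun n t => 1 ^ 2 * ∑ m ∈ Finset.range (n + 1), 1 / (1 + 1 * t + m) ^ 2 -
        (1 / (1 + t) + 1 / (1 + t) ^ 2)) (c := 0) ?_ ?_ ?_ tendsto_const_nhds ?_
    · intro n x (hx : 0 ≤ x)
      refine (hasDerivAt_logGammaSeq_one_add_mul zero_le_one hx n).fun_sub ?_
      refine ((hasDerivAt_id x).fun_mul ((((hasDerivAt_id x).const_add 1).log
        (by simp; positivity)).add_const (Real.log (Real.pi / 6)))).congr_deriv ?_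
      simp only [id]
      field_simp
      ring
    · intro n x (hx : 0 ≤ x)
      refine (hasDerivAt_mul_log_sub_sum_one_div zero_le_one hx n).fun_sub ?_
      have h1 := (hasDerivAt_id x).const_add 1
      have hne : 1 + id x ≠ 0 := by simp; positivity
      simpa [neg_div] using ((h1.log hne).add_const (Real.log (Real.pi / 6))).fun_add
        ((h1.fun_inv hne).const_sub 1)
    · intro n x (hx : 0 ≤ x)
      have h := sum_one_div_sq_le' (x := 1 + x) (by positivity) n
      have h' : 1 / (1 + x + 1 / 2) ≤ 1 / (1 + x) :=
        one_div_le_one_div_of_le (by positivity) (by linarith)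
      simp only [one_mul, one_pow, Pi.zero_apply]
      linarith
    · intro x (hx : 0 ≤ x)
      exact (tendsto_logGammaSeq_log_Gamma (by positivity)).sub_const _
  have h := hconc.nonpos_of_left_eq_zero (a := 0) (b := 1) (t := t) (by simp)
    (Set.mem_Ici.2 (by linarith)) one_pos ht (by simp) ?_
  · rw [one_mul] at h
    linarith
  · have : 0 ≤ Real.log (2 * (Real.pi / 6)) :=
      Real.log_nonneg (by linarith [Real.pi_gt_three])
    rw [Real.log_mul two_ne_zero (by positivity)] at this
    norm_num [Real.Gamma_two]
    linarith

lemma log_Gamma_one_add_le_half_mul_log {t : ℝ} (ht : 2 ≤ t) :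
    Real.log (Real.Gamma (1 + t)) ≤
      t / 2 * (Real.log (t + 1) + Real.log (t + 2) - Real.log 6) := by
  have hconc : ConcaveOn ℝ (Set.Ici 1) (fun t => Real.log (Real.Gamma (1 + 1 * t)) -
      t / 2 * (Real.log (t + 1) + Real.log (t + 2) - Real.log 6)) := by
    refine concaveOn_of_tendsto_of_hasDerivAt2_le (convex_Ici 1)
      (f := fun n t => logGammaSeq (1 + 1 * t) n -
        t / 2 * (Real.log (t + 1) + Real.log (t + 2) - Real.log 6))
      (f' := fun n t => 1 * (Real.log n - ∑ m ∈ Finset.range (n + 1), 1 / (1 + 1 * t + m)) -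
        (1 / 2 * (Real.log (t + 1) + Real.log (t + 2) - Real.log 6) +
          t / 2 * (1 / (t + 1) + 1 / (t + 2))))
      (f'' := fun n t => 1 ^ 2 * ∑ m ∈ Finset.range (n + 1), 1 / (1 + 1 * t + m) ^ 2 -
        (1 / 2 * (1 / (t + 1) + 1 / (t + 2)) + (1 / 2 * (1 / (t + 1) + 1 / (t + 2)) +
          t / 2 * (-1 / (t + 1) ^ 2 + -1 / (t + 2) ^ 2))))
      (c := 0) ?_ ?_ ?_ tendsto_const_nhds ?_
    · intro n x (hx : 1 ≤ x)
      refine (hasDerivAt_logGammaSeq_one_add_mul zero_le_one (by linarith) n).fun_sub ?_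
      exact ((hasDerivAt_id x).div_const 2).fun_mul
        (((((hasDerivAt_id x).add_const 1).log (by simp; positivity)).fun_add
        (((hasDerivAt_id x).add_const 2).log (by simp; positivity))).sub_const (Real.log 6))
    · intro n x (hx : 1 ≤ x)
      refine (hasDerivAt_mul_log_sub_sum_one_div zero_le_one (by linarith) n).fun_sub ?_
      have h1 := (hasDerivAt_id x).add_const 1
      have h2 := (hasDerivAt_id x).add_const 2
      have hne1 : id x + 1 ≠ 0 := by simp; positivity
      have hne2 : id x + 2 ≠ 0 := by simp; positivity
      have h3 := ((((h1.log hne1).fun_add (h2.log hne2)).sub_const (Real.log 6)).const_mul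
        (1 / 2)).fun_add (((hasDerivAt_id x).div_const 2).fun_mul
          ((h1.fun_inv hne1).fun_add (h2.fun_inv hne2)))
      simpa using h3
    · intro n x (hx : 1 ≤ x)
      have h := sum_one_div_sq_le' (x := 1 + x) (by positivity) n
      have h' := one_div_sq_add_one_div_le hx
      simp only [one_mul, one_pow, Pi.zero_apply, neg_div]
      linarith
    · intro x (hx : 1 ≤ x)
      exact (tendsto_logGammaSeq_log_Gamma (by positivity)).sub_const _
  have h := hconc.nonpos_of_left_eq_zero (a := 1) (b := 2) (t := t) (by simp)
    (Set.mem_Ici.2 (by linarith)) one_lt_two ht ?_ ?_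
  · rw [one_mul] at h
    linarith
  · have : Real.log 6 = Real.log 2 + Real.log 3 := by
      rw [← Real.log_mul two_ne_zero three_ne_zero]; norm_num
    norm_num [Real.Gamma_two, this]
  · have : Real.log 12 = Real.log 3 + Real.log 4 := by
      rw [← Real.log_mul three_ne_zero four_ne_zero]; norm_num
    have : Real.log 12 = Real.log 2 + Real.log 6 := by
      rw [← Real.log_mul two_ne_zero (by norm_num)]; norm_num
    have : Real.Gamma (1 + 1 * 2) = 2 := by
      norm_num [Nat.factorial]
    rw [this]
    norm_num
    linarith

lemma concaveOn_log_Gamma_combination {y : ℝ} (hy : 2 ≤ y) :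
    ConcaveOn ℝ (Set.Icc (1 / 2) 1) (fun x => Real.log (Real.Gamma (1 + (y + 2) * x)) -
      (1 + 2 / y) * Real.log (Real.Gamma (1 + y * x)) - Real.log (Real.Gamma (1 + 3 * x)) +
      3 * Real.log (Real.Gamma (1 + 1 * x))) := by
  have hy0 : 0 ≤ y := by linarith
  refine concaveOn_of_tendsto_of_hasDerivAt2_le (convex_Icc _ _)
    (f := fun n x => logGammaSeq (1 + (y + 2) * x) n -
      (1 + 2 / y) * logGammaSeq (1 + y * x) n - logGammaSeq (1 + 3 * x) n +
      3 * logGammaSeq (1 + 1 * x) n)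
    (c := fun n => ((1 + 2 / y) * y ^ 2 + 9) * (1 / ((n : ℝ) + 1)))
    (fun n x hx => by
      have hx0 : 0 ≤ x := by linarith [hx.1]
      exact (((hasDerivAt_logGammaSeq_one_add_mul (by positivity) hx0 n).fun_sub
        ((hasDerivAt_logGammaSeq_one_add_mul hy0 hx0 n).const_mul _)).fun_sub
        (hasDerivAt_logGammaSeq_one_add_mul zero_le_three hx0 n)).fun_add
        ((hasDerivAt_logGammaSeq_one_add_mul zero_le_one hx0 n).const_mul _))
    (fun n x hx => by
      have hx0 : 0 ≤ x := by linarith [hx.1]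
      exact (((hasDerivAt_mul_log_sub_sum_one_div (by positivity) hx0 n).fun_sub
        ((hasDerivAt_mul_log_sub_sum_one_div hy0 hx0 n).const_mul _)).fun_sub
        (hasDerivAt_mul_log_sub_sum_one_div zero_le_three hx0 n)).fun_add
        ((hasDerivAt_mul_log_sub_sum_one_div zero_le_one hx0 n).const_mul _)) ?_ ?_ ?_
  · intro n x hx
    have hx0 : 0 < x := by linarith [hx.1]
    have half (c : ℝ) : 1 + c * x - 1 / 2 = c * x + 1 / 2 := by ring
    have lt {c : ℝ} (hc : 0 ≤ c) : 1 / 2 < 1 + c * x := by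
      have := mul_nonneg hc hx0.le
      linarith
    have h1 := sum_one_div_sq_le (lt (c := y + 2) (by positivity)) (n + 1)
    have h2 := le_sum_one_div_sq (lt hy0) n
    have h3 := le_sum_one_div_sq (lt zero_le_three) n
    have h4 := sum_one_div_sq_le (lt zero_le_one) (n + 1)
    rw [half] at h1 h2 h3 h4
    have k1 := mul_le_mul_of_nonneg_left h1 (sq_nonneg (y + 2))
    have k2 := mul_le_mul_of_nonneg_left h2 (by positivity : 0 ≤ (1 + 2 / y) * y ^ 2)
    have := second_deriv_bound_nonpos hx.1 hx.2 hy
    rw [one_mul x] at h4 ⊢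
    linarith
  · have h : Tendsto (fun n : ℕ => 1 / ((n : ℝ) + 1)) atTop (𝓝 0) :=
      tendsto_one_div_add_atTop_nhds_zero_nat
    simpa using h.const_mul ((1 + 2 / y) * y ^ 2 + 9)
  · intro x hx
    have hx0 : 0 < x := by linarith [hx.1]
    exact (((tendsto_logGammaSeq_log_Gamma (by positivity)).sub
      ((tendsto_logGammaSeq_log_Gamma (by positivity)).const_mul _)).sub
      (tendsto_logGammaSeq_log_Gamma (by positivity))).add
      ((tendsto_logGammaSeq_log_Gamma (by positivity)).const_mul _)

lemma log_Gamma_combination_nonneg_half {y : ℝ} (hy : 2 ≤ y) :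
    0 ≤ Real.log (Real.Gamma (1 + (y + 2) * (1 / 2))) -
      (1 + 2 / y) * Real.log (Real.Gamma (1 + y * (1 / 2))) -
      Real.log (Real.Gamma (1 + 3 * (1 / 2))) +
      3 * Real.log (Real.Gamma (1 + 1 * (1 / 2))) := by
  obtain ⟨t, rfl⟩ : ∃ t, y = 2 * t := ⟨y / 2, by ring⟩
  have ht : 1 ≤ t := by linarith
  have h := log_Gamma_one_add_le_mul_log ht
  have h0 : 1 + t ≠ 0 := by positivity
  have hG : 0 < Real.Gamma (1 + t) := Real.Gamma_pos_of_pos (by positivity)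
  have e1 : Real.Gamma (1 + (2 * t + 2) * (1 / 2)) = (1 + t) * Real.Gamma (1 + t) := by
    rw [← Real.Gamma_add_one h0]; ring_nf
  have e2 : Real.Gamma (1 + 1 * (1 / 2)) = √Real.pi / 2 := by
    rw [show (1 : ℝ) + 1 * (1 / 2) = 1 / 2 + 1 by norm_num, Real.Gamma_add_one (by norm_num),
      Real.Gamma_one_half_eq]; ring
  have e3 : Real.Gamma (1 + 3 * (1 / 2)) = 3 / 2 * (√Real.pi / 2) := by
    rw [← e2, show (1 : ℝ) + 1 * (1 / 2) = 3 / 2 by norm_num, ← Real.Gamma_add_one (by norm_num)]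
    norm_num
  have hs : 0 < √Real.pi / 2 := by positivity
  have e4 : Real.log (Real.pi / 6) = 2 * Real.log (√Real.pi / 2) - Real.log (3 / 2) := by
    rw [← Real.log_rpow hs, ← Real.log_div (by positivity) (by positivity)]
    congr 1
    norm_num [div_pow, Real.sq_sqrt Real.pi_pos.le]
    ring
  rw [e1, e2, e3, Real.log_mul h0 hG.ne', Real.log_mul (by positivity) hs.ne',
    show 2 * t * (1 / 2) = t by ring, show 2 / (2 * t) = 1 / t by field_simp]
  have h' : 1 / t * Real.log (Real.Gamma (1 + t)) ≤ Real.log (1 + t) + Real.log (Real.pi / 6) := by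
    rw [one_div_mul_eq_div, div_le_iff₀' (by positivity)]
    exact h
  linarith

lemma log_Gamma_combination_nonneg_one {y : ℝ} (hy : 2 ≤ y) :
    0 ≤ Real.log (Real.Gamma (1 + (y + 2) * 1)) -
      (1 + 2 / y) * Real.log (Real.Gamma (1 + y * 1)) - Real.log (Real.Gamma (1 + 3 * 1)) +
      3 * Real.log (Real.Gamma (1 + 1 * 1)) := by
  have h := log_Gamma_one_add_le_half_mul_log hy
  have hG : 0 < Real.Gamma (1 + y) := Real.Gamma_pos_of_pos (by positivity)
  have e1 : Real.Gamma (1 + (y + 2) * 1) = (y + 2) * ((y + 1) * Real.Gamma (1 + y)) := by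
    rw [add_comm 1 y, ← Real.Gamma_add_one (by positivity), show y + 1 + 1 = y + 2 by ring,
      ← Real.Gamma_add_one (by positivity)]
    ring_nf
  have e2 : Real.Gamma (1 + 3 * 1) = 6 := by norm_num [Nat.factorial]
  have e3 : Real.Gamma (1 + 1 * 1) = 1 := by norm_num [Real.Gamma_two]
  rw [e1, e2, e3, Real.log_mul (by positivity) (by positivity),
    Real.log_mul (by positivity) hG.ne', mul_one y, Real.log_one]
  have h' : 2 / y * Real.log (Real.Gamma (1 + y)) ≤
      Real.log (y + 1) + Real.log (y + 2) - Real.log 6 := by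
    rw [div_mul_eq_mul_div, div_le_iff₀ (by positivity)]
    linarith
  linarith

/-- For `1/2 ≤ x ≤ 1` and `y ≥ 2`,
`Γ(1+xy)^(1+2/y) / Γ(1+(y+2)x) ≤ Γ(1+x)³ / Γ(1+3x)`. -/
theorem gamma_ratio_ineq (x y : ℝ) (hx1 : 1 / 2 ≤ x) (hx2 : x ≤ 1) (hy : 2 ≤ y) :
    Real.Gamma (1 + x * y) ^ (1 + 2 / y) / Real.Gamma (1 + (y + 2) * x) ≤
      Real.Gamma (1 + x) ^ 3 / Real.Gamma (1 + 3 * x) := by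
  have hx0 : 0 < x := by linarith
  have h := (concaveOn_log_Gamma_combination hy).min_le_of_mem_Icc
    (by norm_num) (by norm_num) (Set.mem_Icc.2 ⟨hx1, hx2⟩)
  have h' := (le_min (log_Gamma_combination_nonneg_half hy)
    (log_Gamma_combination_nonneg_one hy)).trans h
  have hG {z : ℝ} (hz : 0 < z) : 0 < Real.Gamma z := Real.Gamma_pos_of_pos hz
  have h1 : 0 < Real.Gamma (1 + x * y) := hG (by positivity)
  have h2 : 0 < Real.Gamma (1 + (y + 2) * x) := hG (by positivity)
  have h3 : 0 < Real.Gamma (1 + x) := hG (by positivity)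
  have h4 : 0 < Real.Gamma (1 + 3 * x) := hG (by positivity)
  rw [← Real.log_le_log_iff (by positivity) (by positivity), Real.log_div (by positivity) h2.ne',
    Real.log_div (by positivity) h4.ne', Real.log_rpow h1, Real.log_pow]
  rw [mul_comm y x, one_mul] at h'
  push_cast
  linarith
end

section
/- For every integer n ≥ 5, every p ∈ [1,2], and every integer k with 1 ≤ k ≤ (n−1)/2, one has Γ(n/p + 1)^{1/n} / (n^{1/p} · Γ(1/p + 1)) ≥ Γ(k/2 + 1)^{1/k} / (n^{1/2} · Γ(1/2 + 1)), where Γ denotes the Euler Gamma function. -/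
open Real Filter Topology in
theorem tendsto_log_Gamma_add_one {x : ℝ} (hx : 0 < x) :
    Tendsto (fun N : ℕ => x * log N + log (N.factorial : ℝ) -
      ∑ m ∈ Finset.range N, log (x + (m + 1))) atTop (𝓝 (log (Gamma (x + 1)))) := by
  have h := (BohrMollerup.tendsto_log_gamma hx).add_const (log x)
  have e : log (Gamma (x + 1)) = log (Gamma x) + log x := by
    rw [Gamma_add_one hx.ne', log_mul hx.ne' (Gamma_pos_of_pos hx).ne', add_comm]
  rw [e]
  refine h.congr fun N => ?_
  simp only [BohrMollerup.logGammaSeq, Finset.sum_range_succ', Nat.cast_add, Nat.cast_one,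
    Nat.cast_zero, add_zero]
  ring

open Real in
theorem log_add_sub_log_add_le {s t u v c : ℝ} (ht : 0 < t) (hts : t ≤ s) (hu : 0 ≤ u)
    (hc : 0 < c) (huv : u ≤ c * v) :
    log (s + v) - log (t + v) ≤ log (c * s + u) - log (c * t + u) := by
  have hs : 0 < s := ht.trans_le hts
  have hv : 0 ≤ v := nonneg_of_mul_nonneg_right (hu.trans huv) hc
  rw [sub_le_sub_iff, ← log_mul (by positivity) (by positivity),
    ← log_mul (by positivity) (by positivity)]
  apply log_le_log (by positivity)
  nlinarith [mul_nonneg (sub_nonneg.2 huv) (sub_nonneg.2 hts)]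

open Real in
theorem mul_sum_log_sub_le_sum_log_sub {s t : ℝ} (ht : 0 < t) (hts : t ≤ s) {n : ℕ}
    (hn : 0 < n) (m : ℕ) :
    n * ∑ i ∈ Finset.range m, (log (s + (i + 1)) - log (t + (i + 1))) ≤
      ∑ j ∈ Finset.range (n * m), (log (n * s + (j + 1)) - log (n * t + (j + 1))) := by
  induction m with
  | zero => simp
  | succ m ih =>
    rw [Finset.sum_range_succ, mul_add, Nat.mul_succ, Finset.sum_range_add]
    refine add_le_add ih ?_
    rw [← nsmul_eq_mul]
    nth_rewrite 1 [← Finset.card_range n]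
    refine Finset.card_nsmul_le_sum _ _ _ fun j hj => ?_
    refine log_add_sub_log_add_le ht hts (by positivity) (by exact_mod_cast hn) ?_
    have : (j : ℝ) + 1 ≤ n := by exact_mod_cast Finset.mem_range.1 hj
    push_cast
    linarith

open Real Filter Topology in
/-- The function `x ↦ log Γ(n x + 1) - n log Γ(x + 1) - n x log n` is antitone. -/
theorem log_Gamma_mul_add_one_sub_le {s t : ℝ} (ht : 0 < t) (hts : t ≤ s) {n : ℕ}
    (hn : 0 < n) :
    log (Gamma (n * s + 1)) - n * log (Gamma (s + 1)) - n * s * log n ≤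
      log (Gamma (n * t + 1)) - n * log (Gamma (t + 1)) - n * t * log n := by
  have hs : 0 < s := ht.trans_le hts
  have hn' : (0 : ℝ) < n := by exact_mod_cast hn
  have hmul : Tendsto (fun m : ℕ => n * m) atTop atTop :=
    tendsto_id.const_mul_atTop' hn
  have key {x : ℝ} (hx : 0 < x) :=
    (((tendsto_log_Gamma_add_one (mul_pos hn' hx)).comp hmul).sub
      ((tendsto_log_Gamma_add_one hx).const_mul (n : ℝ))).sub_const (n * x * log n)
  refine le_of_tendsto_of_tendsto (key hs) (key ht) ?_
  filter_upwards [eventually_gt_atTop 0] with m hm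
  have hm' : (0 : ℝ) < m := by exact_mod_cast hm
  have := mul_sum_log_sub_le_sum_log_sub ht hts hn m
  simp only [Finset.sum_sub_distrib] at this
  simp only [Function.comp_apply, Nat.cast_mul, log_mul hn'.ne' hm'.ne']
  linarith

open Real in
theorem two_mul_log_Gamma_half_add_one_le (k : ℕ) :
    2 * log (Gamma (k / 2 + 1)) ≤
      log (k.factorial : ℝ) + log π / 2 - k * log 2 + log ((k + 1) / 2) / 2 := by
  have hs : (0 : ℝ) < (k + 1) / 2 := by positivity
  have h1 := congrArg log (Gamma_mul_Gamma_add_half_of_pos hs)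
  have hconv := convexOn_log_Gamma.2 (Set.mem_Ioi.2 hs)
    (Set.mem_Ioi.2 (show (0 : ℝ) < (k + 1) / 2 + 1 by positivity))
    (show (0 : ℝ) ≤ 1 / 2 by norm_num) (show (0 : ℝ) ≤ 1 / 2 by norm_num) (by norm_num)
  have e1 : (1 / 2 : ℝ) • (((k : ℝ) + 1) / 2) + (1 / 2 : ℝ) • (((k : ℝ) + 1) / 2 + 1)
      = k / 2 + 1 := by simp only [smul_eq_mul]; ring
  rw [e1] at hconv
  simp only [Function.comp_apply, smul_eq_mul] at hconv
  rw [Gamma_add_one hs.ne', log_mul hs.ne' (Gamma_pos_of_pos hs).ne'] at hconv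
  have e2 : ((k : ℝ) + 1) / 2 + 1 / 2 = k / 2 + 1 := by ring
  have e3 : 2 * (((k : ℝ) + 1) / 2) = k + 1 := by ring
  rw [e2, e3, Gamma_nat_eq_factorial, log_mul (Gamma_pos_of_pos hs).ne'
      (Gamma_pos_of_pos (by positivity)).ne',
    log_mul (by positivity) (by positivity), log_mul (by positivity) (by positivity),
    log_rpow two_pos, log_sqrt pi_pos.le] at h1
  linarith

open Real in
theorem log_factorial_le {k : ℕ} (hk : k ≠ 0) :
    log (k.factorial : ℝ) ≤ k * log k - k + log k / 2 + 1 := by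
  obtain ⟨m, rfl⟩ := Nat.exists_eq_succ_of_ne_zero hk
  have h := Stirling.log_stirlingSeq'_antitone (Nat.zero_le m)
  have hk' : ((m.succ : ℕ) : ℝ) ≠ 0 := by exact_mod_cast hk
  simp only [Function.comp_apply, Stirling.log_stirlingSeq_formula] at h
  rw [log_mul two_ne_zero hk', log_div hk' (exp_ne_zero _), log_exp] at h
  norm_num at h ⊢
  linarith

open Real in
theorem log_pi_mem_Ioo : log π ∈ Set.Ioo (1.14 : ℝ) 1.15 := by
  have h1 := exp_one_lt_d9
  have h2 := exp_one_gt_d9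
  constructor
  · rw [lt_log_iff_exp_lt pi_pos]
    have : exp 1.14 ^ 50 = exp 1 ^ 57 := by
      rw [← exp_nat_mul, ← exp_nat_mul]; norm_num
    refine lt_trans ?_ pi_gt_d2
    refine lt_of_pow_lt_pow_left₀ 50 (by norm_num) ?_
    rw [this]
    exact (pow_lt_pow_left₀ h1 (exp_pos _).le (by norm_num)).trans (by norm_num)
  · rw [log_lt_iff_lt_exp pi_pos]
    have : exp 1.15 ^ 20 = exp 1 ^ 23 := by
      rw [← exp_nat_mul, ← exp_nat_mul]; norm_num
    refine lt_trans pi_lt_d2 ?_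
    refine lt_of_pow_lt_pow_left₀ 20 (exp_pos _).le ?_
    rw [this]
    exact lt_trans (by norm_num) (pow_lt_pow_left₀ h2 (by norm_num) (by norm_num))

open Real in
theorem log_seven_lt : log 7 < 1.95 := by
  rw [log_lt_iff_lt_exp (by norm_num)]
  have : exp 1.95 ^ 20 = exp 1 ^ 39 := by
    rw [← exp_nat_mul, ← exp_nat_mul]; norm_num
  refine lt_of_pow_lt_pow_left₀ 20 (exp_pos _).le ?_
  rw [this]
  exact lt_trans (by norm_num) (pow_lt_pow_left₀ exp_one_gt_d9 (by norm_num) (by norm_num))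

open Real in
theorem log_add_log_two_pi_mul_div_mono {x y : ℝ} (hx : 5 ≤ x) (hxy : x ≤ y) :
    log x + log (2 * π * x) / x ≤ log y + log (2 * π * y) / y := by
  have hx0 : 0 < x := by linarith
  have hy0 : 0 < y := by linarith
  have hL : log (2 * π * x) ≤ x := by
    have h5 : log x ≤ log 5 + (x / 5 - 1) := by
      have := log_le_sub_one_of_pos (x := x / 5) (by positivity)
      rw [log_div hx0.ne' (by norm_num)] at this
      linarith
    rw [log_mul (by positivity) hx0.ne', log_mul two_ne_zero pi_ne_zero]
    linarith [log_two_lt_d9, log_pi_mem_Ioo.2, log_five_lt_d9]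
  have hmono : log (2 * π * x) ≤ log (2 * π * y) :=
    log_le_log (by positivity) (by gcongr)
  have hxy' := log_le_sub_one_of_pos (x := x / y) (by positivity)
  rw [log_div hx0.ne' hy0.ne'] at hxy'
  have h1 : log (2 * π * x) / y ≤ log (2 * π * y) / y := by gcongr
  have h2 : log (2 * π * x) / x - log (2 * π * x) / y ≤ 1 - x / y := by
    have : log (2 * π * x) / x - log (2 * π * x) / y =
        log (2 * π * x) * ((y - x) / (x * y)) := by field_simp
    rw [this]
    have h3 : 1 - x / y = x * ((y - x) / (x * y)) := by field_simp
    rw [h3]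
    exact mul_le_mul_of_nonneg_right hL (div_nonneg (by linarith) (by positivity))
  linarith

open Real in
theorem log_sub_two_add_le {n : ℕ} (hn : n ≠ 0) :
    log n - 2 + log (2 * π * n) / n ≤ 2 / n * log (n.factorial : ℝ) - log n := by
  have hn' : (0 : ℝ) < n := by exact_mod_cast Nat.pos_of_ne_zero hn
  have h := Stirling.le_log_factorial_stirling hn
  rw [log_mul (by positivity) hn'.ne']
  have := mul_le_mul_of_nonneg_left h (show (0 : ℝ) ≤ 2 / n by positivity)
  have e : 2 / (n : ℝ) * (n * log n - n + log n / 2 + log (2 * π) / 2) =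
      2 * log n - 2 + (log (2 * π) + log n) / n := by field_simp; ring
  linarith

open Real in
theorem log_four_div_pi_add_le_of_three_le {k : ℕ} (hk : 3 ≤ k) :
    log (4 / π) + 2 / k * log (Gamma (k / 2 + 1)) ≤
      log (2 * k + 1) - 2 + log (2 * π * (2 * k + 1)) / (2 * k + 1) := by
  have hk3 : (3 : ℝ) ≤ k := by exact_mod_cast hk
  have hk0 : (0 : ℝ) < k := by linarith
  have hG := two_mul_log_Gamma_half_add_one_le k
  have hF := log_factorial_le (k := k) (by omega)
  obtain ⟨hp1, hp2⟩ := log_pi_mem_Ioo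
  have l1 := log_two_gt_d9
  have l2 := log_two_lt_d9
  have l7 := log_seven_lt
  have h4 : log (4 : ℝ) = 2 * log 2 := by
    rw [show (4 : ℝ) = 2 ^ 2 by norm_num, log_pow]; norm_num
  rw [log_div (by positivity) two_ne_zero] at hG
  rw [log_div (by norm_num) pi_ne_zero, h4]
  set L := log (2 * π * (2 * k + 1)) with hLdef
  have hL : L = log 2 + log π + log (2 * k + 1) := by
    rw [hLdef, log_mul (by positivity) (by positivity), log_mul two_ne_zero pi_ne_zero]
  have hr : 2 / (4 * k + 1) + log 2 + log k ≤ log (2 * (k : ℝ) + 1) := by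
    have := le_log_one_add_of_nonneg (x := 1 / (2 * (k : ℝ))) (by positivity)
    have e : 1 + 1 / (2 * (k : ℝ)) = (2 * k + 1) / (2 * k) := by field_simp
    rw [e, log_div (by positivity) (by positivity), log_mul two_ne_zero hk0.ne'] at this
    have e2 : 2 * (1 / (2 * (k : ℝ))) / (1 / (2 * k) + 2) = 2 / (4 * k + 1) := by
      field_simp
      ring
    linarith
  have hr' : 2 * k * (2 / (4 * k + 1)) ≥ (1 : ℝ) - 1 / 13 := by
    rw [ge_iff_le, mul_div_assoc', le_div_iff₀ (by positivity)]
    linarith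
  have hk1 : log ((k : ℝ) + 1) ≤ 2 * log 2 + ((k + 1) / 4 - 1) := by
    have := log_le_sub_one_of_pos (x := ((k : ℝ) + 1) / 4) (by positivity)
    rw [log_div (by positivity) (by norm_num), h4] at this
    linarith
  have h7 : log (2 * (k : ℝ) + 1) ≤ log 7 + ((2 * k + 1) / 7 - 1) := by
    have := log_le_sub_one_of_pos (x := (2 * (k : ℝ) + 1) / 7) (by positivity)
    rw [log_div (by positivity) (by norm_num)] at this
    linarith
  have hsmall : L / (2 * k + 1) ≤ (log 2 + log π + log 7) / 7 := by
    rw [div_le_iff₀ (by positivity), hL]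
    have hC : 0 ≤ log 2 + log π + log 7 - 1 := by
      linarith [log_pos (show (1 : ℝ) < 7 by norm_num)]
    nlinarith [mul_nonneg hC (sub_nonneg.2 hk3)]
  have hmain : k * (2 * log 2 - log π + 2 / k * log (Gamma (k / 2 + 1))) ≤
      k * (log (2 * k + 1) - 2 + L / (2 * k + 1)) := by
    have e1 : k * (2 * log 2 - log π + 2 / k * log (Gamma (k / 2 + 1))) =
        k * (2 * log 2 - log π) + 2 * log (Gamma (k / 2 + 1)) := by field_simp
    have e2 : k * (L / (2 * k + 1)) = L / 2 - L / (2 * k + 1) / 2 := by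
      field_simp
      ring
    have hkr := mul_le_mul_of_nonneg_left hr hk0.le
    have hc := mul_le_mul_of_nonneg_right hk3
      (show (0 : ℝ) ≤ log 2 + log π - 1 - log 2 - 0.14 by linarith)
    rw [e1, mul_add, e2]
    nlinarith
  exact le_of_mul_le_mul_left hmain hk0

open Real in
theorem log_four_div_pi_le : log (4 / π) ≤ log 5 - 2 + log (2 * π * 5) / 5 := by
  obtain ⟨hp1, hp2⟩ := log_pi_mem_Ioo
  rw [log_mul (by positivity) (by norm_num), log_mul two_ne_zero pi_ne_zero,
    log_div (by norm_num) pi_ne_zero, show (4 : ℝ) = 2 ^ 2 by norm_num, log_pow]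
  push_cast
  linarith [log_two_lt_d9, log_two_gt_d9, log_five_gt_d9]

open Real in
theorem log_four_div_pi_add_le_log_factorial {n k : ℕ} (hn : 5 ≤ n) (hk : 1 ≤ k)
    (hkn : 2 * k + 1 ≤ n) :
    log (4 / π) + 2 / k * log (Gamma (k / 2 + 1)) ≤
      2 / n * log (n.factorial : ℝ) - log n := by
  refine le_trans ?_ (log_sub_two_add_le (by omega))
  obtain hk3 | hk3 := le_or_gt 3 k
  · have h := log_add_log_two_pi_mul_div_mono (x := 2 * k + 1) (y := n)
      (by norm_cast; omega) (by exact_mod_cast hkn)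
    linarith [log_four_div_pi_add_le_of_three_le hk3]
  · have h := log_add_log_two_pi_mul_div_mono (x := 5) (y := n) le_rfl (by exact_mod_cast hn)
    have hG : log (Gamma ((k : ℝ) / 2 + 1)) ≤ 0 := by
      apply log_nonpos (Gamma_pos_of_pos (by positivity)).le
      interval_cases k
      · norm_num
        exact Gamma_three_div_two_lt_one.le
      · norm_num
    have := mul_nonpos_of_nonneg_of_nonpos (show (0 : ℝ) ≤ 2 / k by positivity) hG
    linarith [log_four_div_pi_le]

/-- For `n ≥ 5`, `p ∈ [1,2]` and `1 ≤ k ≤ (n−1)/2`,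
`Γ(n/p+1)^(1/n) / (n^(1/p)·Γ(1/p+1)) ≥ Γ(k/2+1)^(1/k) / (n^(1/2)·Γ(1/2+1))`. -/
theorem gamma_section_ineq (n k : ℕ) (hn : 5 ≤ n) (p : ℝ) (hp1 : 1 ≤ p) (hp2 : p ≤ 2)
    (hk1 : 1 ≤ k) (hk2 : (k : ℝ) ≤ ((n : ℝ) - 1) / 2) :
    Real.Gamma ((n : ℝ) / p + 1) ^ (1 / (n : ℝ)) /
        ((n : ℝ) ^ (1 / p) * Real.Gamma (1 / p + 1)) ≥
      Real.Gamma ((k : ℝ) / 2 + 1) ^ (1 / (k : ℝ)) /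
        ((n : ℝ) ^ ((1 : ℝ) / 2) * Real.Gamma ((1 : ℝ) / 2 + 1)) := by
  have hn0 : (0 : ℝ) < n := by positivity
  have hp0 : 0 < p := by linarith
  have hk0 : (0 : ℝ) < k := by exact_mod_cast hk1
  have hkn : 2 * k + 1 ≤ n := by
    have : 2 * (k : ℝ) + 1 ≤ n := by linarith
    exact_mod_cast this
  have hA := log_Gamma_mul_add_one_sub_le (t := 1 / p) (s := 1) (by positivity)
    (by rw [div_le_one hp0]; exact hp1) (n := n) (by omega)
  have hB := log_four_div_pi_add_le_log_factorial hn hk1 hkn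
  have hG1 : 0 < Real.Gamma ((n : ℝ) / p + 1) := Real.Gamma_pos_of_pos (by positivity)
  have hG2 : 0 < Real.Gamma (1 / p + 1) := Real.Gamma_pos_of_pos (by positivity)
  have hG3 : 0 < Real.Gamma ((k : ℝ) / 2 + 1) := Real.Gamma_pos_of_pos (by positivity)
  have hG4 : Real.Gamma ((1 : ℝ) / 2 + 1) = √Real.pi / 2 := by
    rw [Real.Gamma_add_one (by norm_num), Real.Gamma_one_half_eq]; ring
  have hpi := Real.pi_pos
  rw [hG4, ge_iff_le, ← Real.log_le_log_iff (by positivity) (by positivity),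
    Real.log_div (by positivity) (by positivity), Real.log_div (by positivity) (by positivity),
    Real.log_mul (by positivity) (by positivity), Real.log_mul (by positivity) (by positivity),
    Real.log_rpow hG3, Real.log_rpow hG1, Real.log_rpow hn0, Real.log_rpow hn0,
    Real.log_div (by positivity) two_ne_zero, Real.log_sqrt hpi.le]
  rw [mul_one, Real.Gamma_nat_eq_factorial, one_add_one_eq_two, Real.Gamma_two, Real.log_one,
    mul_one_div] at hA
  rw [Real.log_div (by norm_num) hpi.ne', show (4 : ℝ) = 2 ^ 2 by norm_num, Real.log_pow] at hB
  have hA' := mul_le_mul_of_nonneg_left hA (show (0 : ℝ) ≤ 1 / n by positivity)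
  have e1 : 1 / (n : ℝ) * (Real.log (n.factorial : ℝ) - n * 0 - n * Real.log n) =
      1 / n * Real.log (n.factorial : ℝ) - Real.log n := by field_simp; ring
  have e2 : 1 / (n : ℝ) * (Real.log (Real.Gamma (n / p + 1)) -
      n * Real.log (Real.Gamma (1 / p + 1)) - n / p * Real.log n) =
      1 / n * Real.log (Real.Gamma (n / p + 1)) -
        Real.log (Real.Gamma (1 / p + 1)) - 1 / p * Real.log n := by field_simp
  rw [e1, e2] at hA'
  have e3 : 2 / (k : ℝ) = 2 * (1 / k) := by ring
  have e4 : 2 / (n : ℝ) = 2 * (1 / n) := by ring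
  rw [e3, e4] at hB
  push_cast at hB
  linarith
end
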